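/- Let (S₁, S₂, S₃) be an ε-hypersymplectic structure on (E, B, b) with ε₁ε₂ε₃ = −1, and let T_i and G be the associated transition endomorphisms and pseudo-metric. (i) If ε₁ = ε₂ = ε₃ = −1 (the hypersymplectic case), then (T_i, G) is a hermitian pair for each i = 1, 2, 3. (ii) If ε₁ = ε₂ = 1 and ε₃ = −1 (the para-hypersymplectic case), then (T₁, G) and (T₂, G) are para-hermitian pairs, while (T₃, G) is a hermitian pair. -/

import Mathlib

variable {E : Type*} [AddCommGroup E] [Module ℝ E]

/-- The deformed bracket `b_I(X,Y) = b(I X, Y) + b(X, I Y) - I (b(X,Y))`. -/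
noncomputable def deform (b : E →ₗ[ℝ] E →ₗ[ℝ] E) (I : E →ₗ[ℝ] E) :
    E →ₗ[ℝ] E →ₗ[ℝ] E :=
  b ∘ₗ I + LinearMap.compl₂ b I - LinearMap.compr₂ b I

/-- The Nijenhuis torsion of `I` with respect to `b`:
`T_b I (X,Y) = b(I X, I Y) - I (b_I(X,Y))`. -/
noncomputable def torsion (b : E →ₗ[ℝ] E →ₗ[ℝ] E) (I : E →ₗ[ℝ] E) (X Y : E) : E :=
  b (I X) (I Y) - I (deform b I X Y)

/-- The concomitant `C_b(I,J)(X,Y) = b_{I,J}(X,Y) + b_{J,I}(X,Y)`. -/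
noncomputable def concomitant (b : E →ₗ[ℝ] E →ₗ[ℝ] E) (I J : E →ₗ[ℝ] E) (X Y : E) : E :=
  deform (deform b I) J X Y + deform (deform b J) I X Y

/-- An ε-hypersymplectic structure on `(E, B, b)`: a triple `S i` (indices in `ZMod 3`,
with `3 ≡ 0`) of `B`-skew-symmetric endomorphisms such that `S i ∘ S i = ε i • id`,
`S i ∘ S j = ε₁ε₂ε₃ • (S j ∘ S i)` for `i ≠ j`, and `b_{S i, S i} = ε i • b`. -/
noncomputable def IsEpsHypersymplectic (B : E →ₗ[ℝ] E →ₗ[ℝ] ℝ) (b : E →ₗ[ℝ] E →ₗ[ℝ] E)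
    (ε : ZMod 3 → ℝ) (S : ZMod 3 → E →ₗ[ℝ] E) : Prop :=
  (∀ i, ∀ X Y : E, B (S i X) Y = - B X (S i Y)) ∧
  (∀ i, S i ∘ₗ S i = ε i • (LinearMap.id : E →ₗ[ℝ] E)) ∧
  (∀ i j, i ≠ j → S i ∘ₗ S j = (ε 0 * ε 1 * ε 2) • (S j ∘ₗ S i)) ∧
  (∀ i, deform (deform b (S i)) (S i) = ε i • b)

/-- The transition endomorphisms `T i := ε (i-1) • (S (i-1) ∘ S (i+1))`. -/
noncomputable def transMor (ε : ZMod 3 → ℝ) (S : ZMod 3 → E →ₗ[ℝ] E) (i : ZMod 3) :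
    E →ₗ[ℝ] E :=
  ε (i - 1) • (S (i - 1) ∘ₗ S (i + 1))

/-- The endomorphism `G := S₃ ∘ S₂ ∘ S₁` (with `S₃ = S 0`). -/
noncomputable def metricG (S : ZMod 3 → E →ₗ[ℝ] E) : E →ₗ[ℝ] E :=
  S 0 ∘ₗ S 2 ∘ₗ S 1


/-- A hermitian pair `(T, G)`: `T` is a `B`-skew-symmetric complex structure
(`T ∘ T = -id`, vanishing Nijenhuis torsion), `G` is a pseudo-metric (`B`-symmetric
with `G ∘ G = id`), and `B(G(T X), T Y) = B(G X, Y)`. -/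
noncomputable def HermitianPair (B : E →ₗ[ℝ] E →ₗ[ℝ] ℝ) (b : E →ₗ[ℝ] E →ₗ[ℝ] E)
    (T G : E →ₗ[ℝ] E) : Prop :=
  (∀ X Y : E, B (T X) Y = - B X (T Y)) ∧
  T ∘ₗ T = -(LinearMap.id : E →ₗ[ℝ] E) ∧
  (∀ X Y : E, torsion b T X Y = 0) ∧
  (∀ X Y : E, B (G X) Y = B X (G Y)) ∧
  G ∘ₗ G = (LinearMap.id : E →ₗ[ℝ] E) ∧
  (∀ X Y : E, B (G (T X)) (T Y) = B (G X) Y)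

/-- A para-hermitian pair `(T, G)`: `T` is a `B`-skew-symmetric para-complex structure
(`T ∘ T = id`, vanishing Nijenhuis torsion), `G` is a pseudo-metric, and
`B(G(T X), T Y) = -B(G X, Y)`. -/
noncomputable def ParaHermitianPair (B : E →ₗ[ℝ] E →ₗ[ℝ] ℝ) (b : E →ₗ[ℝ] E →ₗ[ℝ] E)
    (T G : E →ₗ[ℝ] E) : Prop :=
  (∀ X Y : E, B (T X) Y = - B X (T Y)) ∧
  T ∘ₗ T = (LinearMap.id : E →ₗ[ℝ] E) ∧
  (∀ X Y : E, torsion b T X Y = 0) ∧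
  (∀ X Y : E, B (G X) Y = B X (G Y)) ∧
  G ∘ₗ G = (LinearMap.id : E →ₗ[ℝ] E) ∧
  (∀ X Y : E, B (G (T X)) (T Y) = - B (G X) Y)

/-- If `I` squares to `c • id` and `b_{I,I} = c • b`, then `I` is a Nijenhuis morphism. -/
theorem torsion_eq_zero_of_deform_deform (b : E →ₗ[ℝ] E →ₗ[ℝ] E) (I : E →ₗ[ℝ] E) (c : ℝ)
    (hI : ∀ X, I (I X) = c • X) (hb : deform (deform b I) I = c • b) (X Y : E) :
    torsion b I X Y = 0 := by
  have h := LinearMap.congr_fun₂ hb X Y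
  simp only [torsion, deform, LinearMap.add_apply, LinearMap.sub_apply, LinearMap.comp_apply,
    LinearMap.compl₂_apply, LinearMap.compr₂_apply, LinearMap.smul_apply, map_add, map_sub,
    hI, map_smul] at h ⊢
  linear_combination (norm := module) (1 / 2 : ℝ) • h

theorem torsion_smul (b : E →ₗ[ℝ] E →ₗ[ℝ] E) (I : E →ₗ[ℝ] E) (c : ℝ) (X Y : E) :
    torsion b (c • I) X Y = (c * c) • torsion b I X Y := by
  simp only [torsion, deform, LinearMap.add_apply, LinearMap.sub_apply, LinearMap.comp_apply,
    LinearMap.compl₂_apply, LinearMap.compr₂_apply, LinearMap.smul_apply, map_add, map_sub,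
    map_smul]
  module

/-- The composition of two anticommuting Nijenhuis morphisms that square to `±id` is again
a Nijenhuis morphism. -/
theorem torsion_comp_eq_zero (b : E →ₗ[ℝ] E →ₗ[ℝ] E) (I J : E →ₗ[ℝ] E) (α β : ℝ)
    (hα : α = 1 ∨ α = -1) (hβ : β = 1 ∨ β = -1)
    (hI : ∀ X, I (I X) = α • X) (hJ : ∀ X, J (J X) = β • X)
    (hIJ : ∀ X, J (I X) = -I (J X))
    (tI : ∀ X Y, torsion b I X Y = 0) (tJ : ∀ X Y, torsion b J X Y = 0) (X Y : E) :
    torsion b (I ∘ₗ J) X Y = 0 := by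
  have h₁ := congrArg J (tI (I X) (I (J Y)))
  have h₂ := tI (I (J X)) (I (J Y))
  have h₃ := congrArg I (congrArg J (tI (J X) (I Y)))
  have h₄ := congrArg I (tJ (I X) Y)
  have h₅ := congrArg I (tI (I X) Y)
  have h₆ := congrArg I (congrArg J (tJ X (I (J Y))))
  have h₇ := congrArg J (tJ (J X) Y)
  have h₈ := congrArg J (tJ (I (J X)) (I Y))
  simp only [torsion, deform, LinearMap.add_apply, LinearMap.sub_apply, LinearMap.comp_apply,
    LinearMap.compl₂_apply, LinearMap.compr₂_apply, LinearMap.smul_apply, LinearMap.neg_apply,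
    map_add, map_sub, map_neg, map_zero, hI, hJ, hIJ, map_smul]
    at h₁ h₂ h₃ h₄ h₅ h₆ h₇ h₈ ⊢
  rcases hα with rfl | rfl <;> rcases hβ with rfl | rfl
  · linear_combination (norm := module) (1 / 2 : ℝ) • (h₂ + h₅ + h₇ + h₈ - h₁ - h₃ - h₄ - h₆)
  · linear_combination (norm := module) (1 / 2 : ℝ) • (h₂ + h₆ - h₁ - h₃ - h₄ - h₅ - h₇ - h₈)
  · linear_combination (norm := module) (1 / 2 : ℝ) • (h₁ + h₃ + h₈ - h₂ - h₄ - h₅ - h₆ - h₇)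
  · linear_combination (norm := module) (1 / 2 : ℝ) • (h₁ + h₃ + h₅ + h₆ + h₇ - h₂ - h₄ - h₈)

/-- The transition endomorphisms and the pseudo-metric of an `ε`-hypersymplectic structure with
`ε₁ε₂ε₃ = -1`, uniformly in the signs: `T i` squares to `ε i` and commutes with `G`. -/
theorem transMor_metricG (B : E →ₗ[ℝ] E →ₗ[ℝ] ℝ) (b : E →ₗ[ℝ] E →ₗ[ℝ] E)
    (ε : ZMod 3 → ℝ) (S : ZMod 3 → E →ₗ[ℝ] E)
    (hε : ∀ i, ε i = 1 ∨ ε i = -1) (he : ε 0 * ε 1 * ε 2 = -1)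
    (hS : IsEpsHypersymplectic B b ε S) (i : ZMod 3) :
    (∀ X Y : E, B (transMor ε S i X) Y = - B X (transMor ε S i Y)) ∧
    transMor ε S i ∘ₗ transMor ε S i = ε i • (LinearMap.id : E →ₗ[ℝ] E) ∧
    (∀ X Y : E, torsion b (transMor ε S i) X Y = 0) ∧
    (∀ X Y : E, B (metricG S X) Y = B X (metricG S Y)) ∧
    metricG S ∘ₗ metricG S = (LinearMap.id : E →ₗ[ℝ] E) ∧
    (∀ X Y : E, B (metricG S (transMor ε S i X)) (transMor ε S i Y) =
      -(ε i * B (metricG S X) Y)) := by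
  obtain ⟨hskew, hsq, hanti, hdef⟩ := hS
  have sq : ∀ i X, S i (S i X) = ε i • X := fun i X => LinearMap.congr_fun (hsq i) X
  have anti : ∀ i j, i ≠ j → ∀ X, S i (S j X) = -S j (S i X) := fun i j hij X => by
    simpa [he] using LinearMap.congr_fun (hanti i j hij) X
  have tor : ∀ i X Y, torsion b (S i) X Y = 0 := fun i =>
    torsion_eq_zero_of_deform_deform b (S i) (ε i) (sq i) (hdef i)
  have hne : ∀ i : ZMod 3, i - 1 ≠ i + 1 := by decide
  have a10 := anti 1 0 (by decide)
  have a20 := anti 2 0 (by decide)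
  have a21 := anti 2 1 (by decide)
  have hεsq : ∀ i, ε i * ε i = 1 := fun i => by rcases hε i with h | h <;> simp [h]
  have hεi : ε (i - 1) * ε (i + 1) = -ε i := by
    have h : ε i * (ε (i - 1) * ε (i + 1)) = -1 := by
      rw [← he]
      fin_cases i
      · change ε 0 * (ε 2 * ε 1) = _
        ring
      · change ε 1 * (ε 0 * ε 2) = _
        ring
      · change ε 2 * (ε 1 * ε 0) = _
        ring
    linear_combination ε i * h - ε (i - 1) * ε (i + 1) * hεsq i
  have skewT : ∀ X Y, B (transMor ε S i X) Y = - B X (transMor ε S i Y) := fun X Y => by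
    simp [transMor, hskew, anti _ _ (hne i)]
  have sqT : ∀ X, transMor ε S i (transMor ε S i X) = ε i • X := fun X => by
    simp only [transMor, LinearMap.smul_apply, LinearMap.comp_apply, map_smul,
      anti _ _ (hne i).symm, map_neg, sq, smul_neg, smul_smul]
    rw [← neg_smul]
    congr 1
    linear_combination (-ε (i - 1) * ε (i - 1)) * hεi + ε i * hεsq (i - 1)
  have commS : ∀ k X, metricG S (S k X) = S k (metricG S X) := fun k X => by
    fin_cases k
    · change metricG S (S 0 X) = S 0 (metricG S X)
      simp [metricG, a10, a20]
    · change metricG S (S 1 X) = S 1 (metricG S X)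
      simp [metricG, a10, a21]
    · change metricG S (S 2 X) = S 2 (metricG S X)
      simp [metricG, a20, a21]
  have commT : ∀ X, metricG S (transMor ε S i X) = transMor ε S i (metricG S X) := fun X => by
    simp [transMor, commS]
  refine ⟨skewT, LinearMap.ext sqT, fun X Y => ?_, fun X Y => ?_, LinearMap.ext fun X => ?_,
    fun X Y => ?_⟩
  · rw [transMor, torsion_smul, torsion_comp_eq_zero b _ _ _ _ (hε (i - 1)) (hε (i + 1)) (sq _)
      (sq _) (anti _ _ (hne i).symm) (tor _) (tor _), smul_zero]
  · simp [metricG, hskew, a10, a20, a21]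
  · simp only [metricG, LinearMap.comp_apply, a10, a20, a21, map_neg, sq, map_smul, smul_smul,
      neg_neg, LinearMap.id_apply, smul_neg]
    rw [← neg_smul]
    convert one_smul ℝ X using 2
    linear_combination -he
  · rw [commT, skewT, sqT, map_smul, smul_eq_mul]

theorem statement13 (B : E →ₗ[ℝ] E →ₗ[ℝ] ℝ) (b : E →ₗ[ℝ] E →ₗ[ℝ] E)
    (ε : ZMod 3 → ℝ) (S : ZMod 3 → E →ₗ[ℝ] E)
    (hε : ∀ i, ε i = 1 ∨ ε i = -1)
    (hBsymm : ∀ X Y : E, B X Y = B Y X)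
    (hBnd : ∀ X : E, (∀ Y : E, B X Y = 0) → X = 0)
    (he : ε 0 * ε 1 * ε 2 = -1)
    (hS : IsEpsHypersymplectic B b ε S) :
    ((∀ i, ε i = -1) → ∀ i, HermitianPair B b (transMor ε S i) (metricG S)) ∧
    ((ε 1 = 1 ∧ ε 2 = 1 ∧ ε 0 = -1) →
      ParaHermitianPair B b (transMor ε S 1) (metricG S) ∧
      ParaHermitianPair B b (transMor ε S 2) (metricG S) ∧
      HermitianPair B b (transMor ε S 0) (metricG S)) := by
  have key := transMor_metricG B b ε S hε he hS
  have herm : ∀ i, ε i = -1 → HermitianPair B b (transMor ε S i) (metricG S) := fun i hi => by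
    simpa [HermitianPair, hi] using key i
  have para : ∀ i, ε i = 1 → ParaHermitianPair B b (transMor ε S i) (metricG S) := fun i hi => by
    simpa [ParaHermitianPair, hi] using key i
  exact ⟨fun h i => herm i (h i), fun ⟨h₁, h₂, h₀⟩ => ⟨para 1 h₁, para 2 h₂, herm 0 h₀⟩⟩
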